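/- For every p > 0 there exists a constant C_p > 0 such that the following holds. Let A ∈ ℝ^{n×d} with n ≥ 2 and A ≠ 0, with rows a_1,…,a_n, and for i ∈ [n] let A_i denote the submatrix consisting of the first i rows. Define the i-th online ℓ_p sensitivity s_i = sup{ |a_iᵀx|^p / ‖A_i x‖_p^p : x ∈ rowspan(A_i), x ≠ 0 }, and let κ^{OL} be the online condition number of A, namely the ratio between the largest singular value of A and the minimum over i ∈ [n] of the smallest nonzero singular value of A_i. Then ∑_{i=1}^n s_i ≤ (C_p · d · log(n·κ^{OL}))^{max(1, p/2)}. -/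

import Mathlib

open Finset

/-- The Euclidean norm of a real vector. -/
noncomputable def l2norm {m : ℕ} (y : Fin m → ℝ) : ℝ := Real.sqrt (∑ i, y i ^ 2)

/-- The row span of the first rows `a_1, …, a_i` of `A` (rows with index `≤ i`). -/
def prefixSpan {n d : ℕ} (A : Matrix (Fin n) (Fin d) ℝ) (i : Fin n) :
    Submodule ℝ (Fin d → ℝ) :=
  Submodule.span ℝ ((fun j => A j) '' {j : Fin n | j ≤ i})

/-- `‖A_i x‖_p^p` where `A_i` is the submatrix of the rows with index `≤ i`. -/
noncomputable def prefixLpPow (p : ℝ) {n d : ℕ} (A : Matrix (Fin n) (Fin d) ℝ)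
    (i : Fin n) (x : Fin d → ℝ) : ℝ :=
  ∑ j ∈ Finset.univ.filter (fun j : Fin n => j ≤ i), |∑ k, A j k * x k| ^ p

/-- `‖A_i x‖₂` where `A_i` is the submatrix of the rows with index `≤ i`. -/
noncomputable def prefixL2 {n d : ℕ} (A : Matrix (Fin n) (Fin d) ℝ)
    (i : Fin n) (x : Fin d → ℝ) : ℝ :=
  Real.sqrt (∑ j ∈ Finset.univ.filter (fun j : Fin n => j ≤ i), (∑ k, A j k * x k) ^ 2)

/-- The `i`-th online `ℓ_p` sensitivity
`s_i = sup { |a_iᵀx|^p / ‖A_i x‖_p^p : x ∈ rowspan(A_i), x ≠ 0 }`. -/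
noncomputable def onlineSensitivity (p : ℝ) {n d : ℕ} (A : Matrix (Fin n) (Fin d) ℝ)
    (i : Fin n) : ℝ :=
  sSup {r : ℝ | ∃ x : Fin d → ℝ, x ∈ prefixSpan A i ∧ x ≠ 0 ∧
    r = |∑ k, A i k * x k| ^ p / prefixLpPow p A i x}

/-- The largest singular value of `A`, i.e. `sup_{x ≠ 0} ‖Ax‖₂ / ‖x‖₂`. -/
noncomputable def sigmaMax {n d : ℕ} (A : Matrix (Fin n) (Fin d) ℝ) : ℝ :=
  sSup {r : ℝ | ∃ x : Fin d → ℝ, x ≠ 0 ∧ r = l2norm (A.mulVec x) / l2norm x}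

/-- The minimum over `i` of the smallest nonzero singular value of `A_i`, i.e. the infimum
of `‖A_i x‖₂ / ‖x‖₂` over all `i` and all nonzero `x ∈ rowspan(A_i)`. -/
noncomputable def sigmaMinOnline {n d : ℕ} (A : Matrix (Fin n) (Fin d) ℝ) : ℝ :=
  sInf {r : ℝ | ∃ (i : Fin n) (x : Fin d → ℝ), x ∈ prefixSpan A i ∧ x ≠ 0 ∧
    r = prefixL2 A i x / l2norm x}

/-- The online condition number `κ^{OL}` of `A`. -/
noncomputable def onlineCond {n d : ℕ} (A : Matrix (Fin n) (Fin d) ℝ) : ℝ :=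
  sigmaMax A / sigmaMinOnline A


open Matrix in
lemma aux_quad_add {d : ℕ} (M : Matrix (Fin d) (Fin d) ℝ) (a x : Fin d → ℝ) (c : ℝ) :
    x ⬝ᵥ (M + c • vecMulVec a a) *ᵥ x = x ⬝ᵥ M *ᵥ x + c * (a ⬝ᵥ x) ^ 2 := by
  rw [add_mulVec, dotProduct_add, smul_mulVec, dotProduct_smul, vecMulVec_mulVec]
  simp only [dotProduct_smul, smul_eq_mul, MulOpposite.smul_eq_mul_unop, MulOpposite.unop_op]
  rw [dotProduct_comm x a]
  ring

open Matrix in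
lemma aux_cs {d : ℕ} (M : Matrix (Fin d) (Fin d) ℝ) (hM : M.PosDef) (a x : Fin d → ℝ) :
    (a ⬝ᵥ x) ^ 2 ≤ (a ⬝ᵥ M⁻¹ *ᵥ a) * (x ⬝ᵥ M *ᵥ x) := by
  set z := M⁻¹ *ᵥ a with hz
  have hdet : IsUnit M.det := hM.det_pos.ne'.isUnit
  have hMz : M *ᵥ z = a := by
    rw [hz, mulVec_mulVec, mul_nonsing_inv _ hdet, one_mulVec]
  have hsymm : z ⬝ᵥ M *ᵥ x = a ⬝ᵥ x := by
    have ht : Mᵀ = M := by simpa using hM.isHermitian.eq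
    rw [dotProduct_mulVec, ← mulVec_transpose, ht, hMz]
  have key : ∀ t : ℝ, 0 ≤ (a ⬝ᵥ z) * (t * t) + (2 * (a ⬝ᵥ x)) * t + (x ⬝ᵥ M *ᵥ x) := by
    intro t
    have h := hM.posSemidef.dotProduct_mulVec_nonneg (t • z + x)
    simp only [star_trivial, mulVec_add, mulVec_smul, add_dotProduct, dotProduct_add,
      smul_dotProduct, dotProduct_smul, hMz, hsymm, smul_eq_mul] at h
    rw [dotProduct_comm x a, dotProduct_comm z a] at h
    linarith
  have := discrim_le_zero key
  unfold discrim at this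
  nlinarith

open Matrix in
lemma aux_det {d : ℕ} (M : Matrix (Fin d) (Fin d) ℝ) (hM : M.PosDef) (a : Fin d → ℝ) (c : ℝ) :
    (M + c • vecMulVec a a).det = M.det * (1 + c * (a ⬝ᵥ M⁻¹ *ᵥ a)) := by
  have hdet : IsUnit M.det := hM.det_pos.ne'.isUnit
  have h := det_add_replicateCol_mul_replicateRow (ι := Unit) hdet (c • a) a
  rw [← vecMulVec_eq, smul_vecMulVec] at h
  rw [h]
  congr 1
  simp [Matrix.det_unique, Matrix.mul_apply, dotProduct, mulVec, Finset.sum_mul, Finset.mul_sum]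
  rw [Finset.sum_comm]
  refine Finset.sum_congr rfl fun i _ => Finset.sum_congr rfl fun j _ => by ring

open Matrix in
lemma aux_posDef {d : ℕ} (M : Matrix (Fin d) (Fin d) ℝ) (hM : M.PosDef) (a : Fin d → ℝ) (c : ℝ)
    (hc : 0 ≤ c) : (M + c • vecMulVec a a).PosDef := by
  refine hM.add_posSemidef (PosSemidef.smul ?_ hc)
  simpa using posSemidef_vecMulVec_self_star a

lemma aux_log {w : ℝ} (h0 : 0 ≤ w) (h1 : w ≤ 1) : w ≤ 2 * Real.log (1 + w) := by
  have := Real.one_sub_inv_le_log_of_pos (show 0 < 1 + w by linarith)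
  have h2 : w / 2 ≤ 1 - (1 + w)⁻¹ := by
    rw [show 1 - (1 + w)⁻¹ = w / (1 + w) by field_simp; ring]
    gcongr
    linarith
  linarith

open Matrix in
lemma aux_step {d : ℕ} (p : ℝ) (hp : 0 < p) (M : Matrix (Fin d) (Fin d) ℝ) (hM : M.PosDef)
    (a : Fin d → ℝ) (ν : ℝ) (hν : 0 < ν) (hν1 : ν ≤ 1) :
    ∃ w : ℝ, ν ≤ w ∧ w ≤ 1 ∧ (M + w ^ (1 - 2 / p) • vecMulVec a a).PosDef ∧
      (∀ x, (a ⬝ᵥ x) ^ 2 ≤ w ^ (2 / p) * (x ⬝ᵥ (M + w ^ (1 - 2 / p) • vecMulVec a a) *ᵥ x)) ∧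
      w ≤ ν + 2 * (Real.log (M + w ^ (1 - 2 / p) • vecMulVec a a).det - Real.log M.det) := by
  set u := a ⬝ᵥ M⁻¹ *ᵥ a with hu
  have hu0 : 0 ≤ u := by simpa using hM.inv.posSemidef.dotProduct_mulVec_nonneg a
  have hlog : ∀ c : ℝ, 0 ≤ c → Real.log (M + c • vecMulVec a a).det - Real.log M.det
      = Real.log (1 + c * u) := by
    intro c hc
    rw [aux_det M hM, Real.log_mul hM.det_pos.ne' (by positivity)]
    ring
  have hq : ∀ x, 0 ≤ x ⬝ᵥ M *ᵥ x := fun x => by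
    simpa using hM.posSemidef.dotProduct_mulVec_nonneg x
  have hcs := aux_cs M hM a
  rw [← hu] at hcs
  by_cases h1 : 1 ≤ u
  · refine ⟨1, hν1, le_rfl, ?_, ?_, ?_⟩
    · exact aux_posDef M hM a _ (by simp)
    · intro x
      rw [aux_quad_add]
      simpa using hq x
    · rw [hlog _ (by simp)]
      have := aux_log zero_le_one le_rfl
      rw [Real.one_rpow, one_mul]
      have h2 : Real.log (1 + 1) ≤ Real.log (1 + u) :=
        Real.log_le_log (by norm_num) (by linarith)
      norm_num at this h2
      linarith
  push Not at h1
  have hgen : ∀ w : ℝ, 0 < w → u ^ (p / 2) ≤ w → 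
      (∀ x, (a ⬝ᵥ x) ^ 2 ≤ w ^ (2 / p) *
        (x ⬝ᵥ (M + w ^ (1 - 2 / p) • vecMulVec a a) *ᵥ x)) := by
    intro w hw hwu x
    rw [aux_quad_add]
    have h3 : u ≤ w ^ (2 / p) := by
      have := Real.rpow_le_rpow (by positivity) hwu (show 0 ≤ 2 / p by positivity)
      rwa [← Real.rpow_mul hu0, show p / 2 * (2 / p) = 1 by field_simp, Real.rpow_one] at this
    calc (a ⬝ᵥ x) ^ 2 ≤ u * (x ⬝ᵥ M *ᵥ x) := hcs x
      _ ≤ _ := mul_le_mul h3 (by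
          have : 0 ≤ w ^ (1 - 2 / p) * (a ⬝ᵥ x) ^ 2 := by positivity
          linarith) (hq x) (by positivity)
  by_cases h2 : u ^ (p / 2) ≤ ν
  · refine ⟨ν, le_rfl, hν1, aux_posDef M hM a _ (by positivity), hgen ν hν h2, ?_⟩
    rw [hlog _ (by positivity)]
    have : 0 ≤ Real.log (1 + ν ^ (1 - 2 / p) * u) := Real.log_nonneg (by
      have : 0 ≤ ν ^ (1 - 2 / p) * u := by positivity
      linarith)
    linarith
  · push Not at h2
    have hw0 : 0 < u ^ (p / 2) := hν.trans h2
    have hupos : 0 < u := by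
      rcases hu0.lt_or_eq with h | h
      · exact h
      · rw [← h, Real.zero_rpow (by positivity)] at hw0
        exact absurd hw0 (lt_irrefl _)
    have hw1 : u ^ (p / 2) ≤ 1 := Real.rpow_le_one hu0 h1.le (by positivity)
    refine ⟨u ^ (p / 2), h2.le, hw1, aux_posDef M hM a _ (by positivity), hgen _ hw0 le_rfl, ?_⟩
    rw [hlog _ (by positivity)]
    have h4 : (u ^ (p / 2)) ^ (1 - 2 / p) * u = u ^ (p / 2) := by
      rw [← Real.rpow_mul hu0]
      nth_rewrite 2 [← Real.rpow_one u]
      rw [← Real.rpow_add hupos]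
      congr 1
      field_simp
      ring
    rw [h4]
    have := aux_log hw0.le hw1
    linarith

open Matrix in
/-- The sequence of regularized weighted Gram matrices together with its weights. -/
lemma aux_seq {d : ℕ} (p : ℝ) (hp : 0 < p) (lam : ℝ) (hlam : 0 < lam)
    (a : ℕ → Fin d → ℝ) (ν : ℝ) (hν : 0 < ν) (hν1 : ν ≤ 1) :
    ∃ (w : ℕ → ℝ) (M : ℕ → Matrix (Fin d) (Fin d) ℝ), (∀ k, ν ≤ w k) ∧ (∀ k, w k ≤ 1) ∧
      (∀ k, (M k).PosDef) ∧ M 0 = lam • 1 ∧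
      (∀ k x, x ⬝ᵥ M k *ᵥ x = lam * (x ⬝ᵥ x) +
        ∑ j ∈ range k, w j ^ (1 - 2 / p) * (a j ⬝ᵥ x) ^ 2) ∧
      (∀ k x, (a k ⬝ᵥ x) ^ 2 ≤ w k ^ (2 / p) * (x ⬝ᵥ M (k + 1) *ᵥ x)) ∧
      (∀ k, ∑ j ∈ range k, w j ≤ k * ν + 2 * (Real.log (M k).det - Real.log (M 0).det)) := by
  choose f hf1 hf2 hf3 hf4 hf5 using fun (M : {M : Matrix (Fin d) (Fin d) ℝ // M.PosDef})
    (a : Fin d → ℝ) => aux_step p hp M.1 M.2 a ν hν hν1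
  let N : ℕ → {M : Matrix (Fin d) (Fin d) ℝ // M.PosDef} := fun k =>
    Nat.rec ⟨lam • 1, PosDef.smul PosDef.one hlam⟩
      (fun k M => ⟨_, hf3 M (a k)⟩) k
  have hN : ∀ k, (N (k + 1)).1 =
      (N k).1 + f (N k) (a k) ^ (1 - 2 / p) • vecMulVec (a k) (a k) := fun k => rfl
  refine ⟨fun k => f (N k) (a k), fun k => (N k).1, fun k => hf1 _ _, fun k => hf2 _ _,
    fun k => (N k).2, rfl, ?_, ?_, ?_⟩
  · intro k x
    induction k with
    | zero =>
      change x ⬝ᵥ (lam • (1 : Matrix (Fin d) (Fin d) ℝ)) *ᵥ x = _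
      simp [smul_mulVec]
    | succ k ih =>
      beta_reduce at ih ⊢
      rw [hN, aux_quad_add, ih, Finset.sum_range_succ]
      ring
  · intro k x
    exact hf4 (N k) (a k) x
  · intro k
    induction k with
    | zero => simp
    | succ k ih =>
      rw [Finset.sum_range_succ]
      have := hf5 (N k) (a k)
      rw [← hN] at this
      push_cast
      linarith

open Matrix in
lemma aux_det_le {d : ℕ} (M : Matrix (Fin d) (Fin d) ℝ) (hM : M.PosDef) (L : ℝ)
    (h : ∀ x, x ⬝ᵥ M *ᵥ x ≤ L * (x ⬝ᵥ x)) : M.det ≤ L ^ d := by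
  rw [hM.isHermitian.det_eq_prod_eigenvalues]
  calc ∏ i, ((hM.isHermitian.eigenvalues i : ℝ)) ≤ ∏ _i : Fin d, L := by
        apply Finset.prod_le_prod
        · intro i _
          exact (hM.eigenvalues_pos i).le
        · intro i _
          have h1 := h (hM.isHermitian.eigenvectorBasis i)
          rw [hM.isHermitian.mulVec_eigenvectorBasis, dotProduct_smul, smul_eq_mul] at h1
          have hne : (hM.isHermitian.eigenvectorBasis i : Fin d → ℝ) ≠ 0 := by
            intro h0
            apply hM.isHermitian.eigenvectorBasis.orthonormal.ne_zero i
            ext j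
            simpa using congrFun h0 j
          have hpos : 0 < (hM.isHermitian.eigenvectorBasis i : Fin d → ℝ) ⬝ᵥ
              (hM.isHermitian.eigenvectorBasis i : Fin d → ℝ) := by
            simpa using dotProduct_star_self_pos_iff.mpr hne
          exact le_of_mul_le_mul_right h1 hpos
    _ = L ^ d := by simp

lemma aux_l2norm_sq {m : ℕ} (y : Fin m → ℝ) : l2norm y ^ 2 = y ⬝ᵥ y := by
  unfold l2norm
  rw [Real.sq_sqrt (Finset.sum_nonneg fun i _ => sq_nonneg _)]
  simp [dotProduct, sq]

lemma aux_l2norm_pos {m : ℕ} {y : Fin m → ℝ} (hy : y ≠ 0) : 0 < l2norm y := by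
  have h : 0 < y ⬝ᵥ y := by
    simpa using Matrix.dotProduct_star_self_pos_iff.mpr hy
  rw [← aux_l2norm_sq] at h
  have h0 : 0 ≤ l2norm y := Real.sqrt_nonneg _
  rcases h0.lt_or_eq with h1 | h1
  · exact h1
  · rw [← h1] at h
    norm_num at h

lemma aux_prefixL2_sq {n d : ℕ} (A : Matrix (Fin n) (Fin d) ℝ) (i : Fin n) (x : Fin d → ℝ) :
    prefixL2 A i x ^ 2 = ∑ j ∈ Finset.univ.filter (fun j : Fin n => j ≤ i), (A j ⬝ᵥ x) ^ 2 := by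
  unfold prefixL2
  rw [Real.sq_sqrt (Finset.sum_nonneg fun i _ => sq_nonneg _)]
  rfl

/-- A vector of the row span which is orthogonal to all rows vanishes. -/
lemma aux_inj {n d : ℕ} (A : Matrix (Fin n) (Fin d) ℝ) (i : Fin n) (x : Fin d → ℝ)
    (hx : x ∈ prefixSpan A i) (h : ∀ j ≤ i, A j ⬝ᵥ x = 0) : x = 0 := by
  have key : ∀ y ∈ prefixSpan A i, y ⬝ᵥ x = 0 := by
    intro y hy
    unfold prefixSpan at hy
    induction hy using Submodule.span_induction with
    | mem y hy =>
      obtain ⟨j, hj, rfl⟩ := hy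
      exact h j hj
    | zero => simp
    | add y z _ _ hy hz => rw [add_dotProduct, hy, hz, add_zero]
    | smul c y _ hy => rw [smul_dotProduct, hy, smul_zero]
  exact dotProduct_self_eq_zero.mp (key x hx)

lemma aux_lower {n d : ℕ} (A : Matrix (Fin n) (Fin d) ℝ) (i : Fin n) :
    ∃ ε : ℝ, 0 < ε ∧ ∀ x ∈ prefixSpan A i, ε * l2norm x ≤ prefixL2 A i x := by
  let f : prefixSpan A i →ₗ[ℝ] (Fin n → ℝ) :=
    { toFun := fun x j => if j ≤ i then A j ⬝ᵥ (x : Fin d → ℝ) else 0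
      map_add' := by
        intro x y
        ext j
        by_cases hj : j ≤ i <;> simp [hj, dotProduct_add]
      map_smul' := by
        intro c x
        ext j
        by_cases hj : j ≤ i <;> simp [hj, dotProduct_smul] }
  have hf : ∀ x j, f x j = if j ≤ i then A j ⬝ᵥ (x : Fin d → ℝ) else 0 := fun x j => rfl
  have hker : LinearMap.ker f = ⊥ := by
    rw [LinearMap.ker_eq_bot']
    intro x hx
    apply Subtype.ext
    apply aux_inj A i x x.2
    intro j hj
    have := congrFun hx j
    rw [hf] at this
    simpa [hj] using this
  obtain ⟨K, hK0, hK⟩ := f.exists_antilipschitzWith hker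
  refine ⟨1 / (Real.sqrt d * K + 1), by positivity, fun x hx => ?_⟩
  have h1 : ‖x‖ ≤ K * ‖f ⟨x, hx⟩‖ := by
    have := hK.le_mul_dist ⟨x, hx⟩ 0
    simpa using this
  have hP0 : 0 ≤ prefixL2 A i x := Real.sqrt_nonneg _
  have h2 : ‖f ⟨x, hx⟩‖ ≤ prefixL2 A i x := by
    rw [pi_norm_le_iff_of_nonneg hP0]
    intro j
    rw [hf]
    by_cases hj : j ≤ i
    · simp only [hj, if_true, Real.norm_eq_abs]
      refine abs_le_of_sq_le_sq ?_ hP0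
      rw [aux_prefixL2_sq]
      exact Finset.single_le_sum (f := fun j => (A j ⬝ᵥ x) ^ 2) (fun j _ => sq_nonneg _)
        (by simpa using hj)
    · simpa [hj] using hP0
  have h3 : l2norm x ≤ Real.sqrt d * ‖x‖ := by
    unfold l2norm
    rw [← Real.sqrt_sq (norm_nonneg x), ← Real.sqrt_mul (by positivity)]
    apply Real.sqrt_le_sqrt
    calc ∑ k, x k ^ 2 ≤ ∑ _k : Fin d, ‖x‖ ^ 2 := by
          apply Finset.sum_le_sum
          intro k _
          rw [← sq_abs]
          have := norm_le_pi_norm x k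
          rw [Real.norm_eq_abs] at this
          gcongr
      _ = _ := by simp
  rw [div_mul_eq_mul_div, one_mul, div_le_iff₀ (by positivity)]
  calc l2norm x ≤ Real.sqrt d * (K * prefixL2 A i x) :=
        h3.trans (by gcongr; exact h1.trans (by gcongr))
    _ ≤ prefixL2 A i x * (Real.sqrt d * K + 1) := by nlinarith

lemma aux_row_mem {n d : ℕ} (A : Matrix (Fin n) (Fin d) ℝ) (i : Fin n) : A i ∈ prefixSpan A i :=
  Submodule.subset_span ⟨i, le_refl i, rfl⟩

lemma aux_row_ne {n d : ℕ} (A : Matrix (Fin n) (Fin d) ℝ) (hA : A ≠ 0) : ∃ i, A i ≠ 0 := by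
  by_contra! h
  exact hA (funext h)

lemma aux_sigmaMin_pos {n d : ℕ} (A : Matrix (Fin n) (Fin d) ℝ) (hA : A ≠ 0) :
    0 < sigmaMinOnline A := by
  choose ε hε h using aux_lower A
  obtain ⟨i₀, hi₀⟩ := aux_row_ne A hA
  have : Nonempty (Fin n) := ⟨i₀⟩
  obtain ⟨m, hm⟩ := Finite.exists_min ε
  refine (hε m).trans_le (le_csInf ⟨_, i₀, A i₀, aux_row_mem A i₀, hi₀, rfl⟩ ?_)
  rintro r ⟨i, x, hx, hx0, rfl⟩
  have hpos := aux_l2norm_pos hx0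
  rw [le_div_iff₀ hpos]
  exact (mul_le_mul_of_nonneg_right (hm i) hpos.le).trans (h i x hx)

lemma aux_sigmaMin_le {n d : ℕ} (A : Matrix (Fin n) (Fin d) ℝ) (i : Fin n) (x : Fin d → ℝ)
    (hx : x ∈ prefixSpan A i) (hx0 : x ≠ 0) : sigmaMinOnline A ≤ prefixL2 A i x / l2norm x := by
  apply csInf_le
  · refine ⟨0, ?_⟩
    rintro r ⟨i, x, hx, hx0, rfl⟩
    exact div_nonneg (Real.sqrt_nonneg _) (Real.sqrt_nonneg _)
  · exact ⟨i, x, hx, hx0, rfl⟩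

lemma aux_sigmaMin_sq_le {n d : ℕ} (A : Matrix (Fin n) (Fin d) ℝ) (hA : A ≠ 0)
    (i : Fin n) (x : Fin d → ℝ) (hx : x ∈ prefixSpan A i) :
    sigmaMinOnline A ^ 2 * (x ⬝ᵥ x) ≤
      ∑ j ∈ Finset.univ.filter (fun j : Fin n => j ≤ i), (A j ⬝ᵥ x) ^ 2 := by
  by_cases hx0 : x = 0
  · subst hx0
    simp
  have h := aux_sigmaMin_le A i x hx hx0
  rw [le_div_iff₀ (aux_l2norm_pos hx0)] at h
  rw [← aux_prefixL2_sq, ← aux_l2norm_sq, ← mul_pow]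
  have := (aux_sigmaMin_pos A hA).le
  have := (aux_l2norm_pos hx0).le
  gcongr

lemma aux_sigmaMax_ge {n d : ℕ} (A : Matrix (Fin n) (Fin d) ℝ) (x : Fin d → ℝ) (hx0 : x ≠ 0) :
    l2norm (A.mulVec x) / l2norm x ≤ sigmaMax A := by
  apply le_csSup
  · refine ⟨Real.sqrt (∑ j, A j ⬝ᵥ A j), ?_⟩
    rintro r ⟨x, hx0, rfl⟩
    have hpos := aux_l2norm_pos hx0
    rw [div_le_iff₀ hpos]
    unfold l2norm
    rw [← Real.sqrt_mul (Finset.sum_nonneg fun j _ => by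
      simpa using dotProduct_self_star_nonneg (A j))]
    apply Real.sqrt_le_sqrt
    rw [Finset.sum_mul]
    apply Finset.sum_le_sum
    intro j _
    have := Finset.sum_mul_sq_le_sq_mul_sq Finset.univ (A j) x
    simpa [Matrix.mulVec, dotProduct, sq] using this
  · exact ⟨x, hx0, rfl⟩

lemma aux_sigmaMax_sq_ge {n d : ℕ} (A : Matrix (Fin n) (Fin d) ℝ) (x : Fin d → ℝ) :
    ∑ j, (A j ⬝ᵥ x) ^ 2 ≤ sigmaMax A ^ 2 * (x ⬝ᵥ x) := by
  by_cases hx0 : x = 0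
  · subst hx0
    simp
  have h := aux_sigmaMax_ge A x hx0
  rw [div_le_iff₀ (aux_l2norm_pos hx0)] at h
  have h0 : 0 ≤ l2norm (A.mulVec x) := Real.sqrt_nonneg _
  have h2 : ∑ j, (A j ⬝ᵥ x) ^ 2 = l2norm (A.mulVec x) ^ 2 := by
    rw [aux_l2norm_sq]
    simp [dotProduct, Matrix.mulVec, sq]
  rw [h2, ← aux_l2norm_sq, ← mul_pow]
  gcongr

lemma aux_sigmaMin_le_max {n d : ℕ} (A : Matrix (Fin n) (Fin d) ℝ) (hA : A ≠ 0) :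
    sigmaMinOnline A ≤ sigmaMax A := by
  obtain ⟨i, hi⟩ := aux_row_ne A hA
  refine (aux_sigmaMin_le A i (A i) (aux_row_mem A i) hi).trans
    (le_trans ?_ (aux_sigmaMax_ge A (A i) hi))
  apply div_le_div_of_nonneg_right _ (aux_l2norm_pos hi).le
  unfold prefixL2 l2norm
  apply Real.sqrt_le_sqrt
  exact Finset.sum_le_sum_of_subset_of_nonneg (Finset.subset_univ _)
    (fun j _ _ => sq_nonneg _)

lemma aux_wpow {w N e : ℝ} (hN : 1 ≤ N) (hw : 1 / N ≤ w) (hw1 : w ≤ 1) :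
    N ^ (-|e|) ≤ w ^ e ∧ w ^ e ≤ N ^ |e| := by
  have hN0 : 0 < N := by linarith
  have hi : 0 < 1 / N := by positivity
  have hw0 : 0 < w := hi.trans_le hw
  rcases le_total 0 e with he | he
  · rw [abs_of_nonneg he]
    constructor
    · calc N ^ (-e) = (1 / N) ^ e := by
            rw [one_div, Real.inv_rpow hN0.le, Real.rpow_neg hN0.le]
        _ ≤ _ := by gcongr
    · exact (Real.rpow_le_one hw0.le hw1 he).trans (Real.one_le_rpow hN he)
  · rw [abs_of_nonpos he, neg_neg]
    constructor
    · exact (Real.rpow_le_one_of_one_le_of_nonpos hN he).trans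
        (Real.one_le_rpow_of_pos_of_le_one_of_nonpos hw0 hw1 he)
    · calc w ^ e ≤ (1 / N) ^ e := Real.rpow_le_rpow_of_nonpos hi hw he
        _ = N ^ (-e) := by
            rw [one_div, Real.inv_rpow hN0.le, Real.rpow_neg hN0.le]

/-- The comparison between the quadratic form and the `p`-norm. -/
lemma aux_core {ι : Type*} (s : Finset ι) (p : ℝ) (hp : 0 < p) (w t : ι → ℝ) (Q W : ℝ)
    (hw : ∀ j, 0 < w j) (hQ : 0 < Q) (hW : ∑ j ∈ s, w j ≤ W)
    (ht : ∀ j ∈ s, t j ^ 2 ≤ w j ^ (2 / p) * Q)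
    (hQ2 : Q ≤ 2 * ∑ j ∈ s, w j ^ (1 - 2 / p) * t j ^ 2) :
    Q ^ (p / 2) ≤ 2 ^ (max 1 (p / 2)) * W ^ (max 1 (p / 2) - 1) * ∑ j ∈ s, |t j| ^ p := by
  have habs : ∀ j, ∀ r : ℝ, (t j ^ 2) ^ r = |t j| ^ (2 * r) := by
    intro j r
    rw [← sq_abs, ← Real.rpow_natCast, ← Real.rpow_mul (abs_nonneg _)]
    norm_num
  rcases le_total p 2 with h2 | h2
  · rw [max_eq_left (by linarith)]
    simp only [sub_self, Real.rpow_zero, Real.rpow_one, mul_one]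
    have h3 : ∀ j ∈ s, w j ^ (1 - 2 / p) * t j ^ 2 ≤ |t j| ^ p * Q ^ (1 - p / 2) := by
      intro j hj
      have h4 := Real.rpow_le_rpow (sq_nonneg _) (ht j hj) (show 0 ≤ 1 - p / 2 by linarith)
      rw [Real.mul_rpow (Real.rpow_nonneg (hw j).le _) hQ.le, ← Real.rpow_mul (hw j).le,
        show 2 / p * (1 - p / 2) = -(1 - 2 / p) by field_simp; ring,
        Real.rpow_neg (hw j).le] at h4
      have hc : 0 < w j ^ (1 - 2 / p) := Real.rpow_pos_of_pos (hw j) _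
      have h5 : t j ^ 2 = |t j| ^ p * (t j ^ 2) ^ (1 - p / 2) := by
        rw [habs, ← Real.rpow_add_of_nonneg (abs_nonneg _) hp.le (by linarith), ← sq_abs,
          ← Real.rpow_natCast]
        congr 1
        push_cast
        ring
      have h6 : 0 ≤ |t j| ^ p := by positivity
      calc w j ^ (1 - 2 / p) * t j ^ 2
          = |t j| ^ p * (w j ^ (1 - 2 / p) * (t j ^ 2) ^ (1 - p / 2)) := by
            nth_rewrite 1 [h5]; ring
        _ ≤ |t j| ^ p * (w j ^ (1 - 2 / p) * ((w j ^ (1 - 2 / p))⁻¹ * Q ^ (1 - p / 2))) := by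
            gcongr
        _ = _ := by rw [mul_inv_cancel_left₀ hc.ne']
    have h7 := Finset.sum_le_sum h3
    rw [← Finset.sum_mul] at h7
    have h8 : 0 < Q ^ (1 - p / 2) := by positivity
    have h9 : Q = Q ^ (p / 2) * Q ^ (1 - p / 2) := by
      rw [← Real.rpow_add hQ]
      simp
    refine le_of_mul_le_mul_right ?_ h8
    rw [← h9]
    linarith
  · have hp2 : 1 ≤ p / 2 := by linarith
    rw [max_eq_right hp2]
    have hol := Real.inner_le_weight_mul_Lp_of_nonneg s hp2 w
      (fun j => w j ^ (- (2 / p)) * t j ^ 2) (fun j => (hw j).le)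
      (fun j => mul_nonneg (Real.rpow_nonneg (hw j).le _) (sq_nonneg _))
    have e1 : ∀ j, w j * (w j ^ (-(2 / p)) * t j ^ 2) = w j ^ (1 - 2 / p) * t j ^ 2 := by
      intro j
      rw [← mul_assoc, sub_eq_add_neg, Real.rpow_add (hw j), Real.rpow_one]
    have e2 : ∀ j, w j * (w j ^ (-(2 / p)) * t j ^ 2) ^ (p / 2) = |t j| ^ p := by
      intro j
      rw [Real.mul_rpow (Real.rpow_nonneg (hw j).le _) (sq_nonneg _), habs,
        ← Real.rpow_mul (hw j).le, show -(2 / p) * (p / 2) = -1 by field_simp,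
        Real.rpow_neg_one, mul_inv_cancel_left₀ (hw j).ne']
      congr 1
      ring
    simp only [e1, e2] at hol
    set P := ∑ j ∈ s, |t j| ^ p with hP
    have hP0 : 0 ≤ P := Finset.sum_nonneg fun j _ => by positivity
    have hS0 : 0 ≤ ∑ j ∈ s, w j := Finset.sum_nonneg fun j _ => (hw j).le
    have hW0 : 0 ≤ W := hS0.trans hW
    have hinv : 0 ≤ 1 - (p / 2)⁻¹ := by
      have := inv_le_one_of_one_le₀ hp2
      linarith
    have h1 : Q ≤ 2 * (W ^ (1 - (p / 2)⁻¹) * P ^ (p / 2)⁻¹) := by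
      refine hQ2.trans ?_
      gcongr
      exact hol.trans (by gcongr)
    calc Q ^ (p / 2) ≤ (2 * (W ^ (1 - (p / 2)⁻¹) * P ^ (p / 2)⁻¹)) ^ (p / 2) := by gcongr
      _ = _ := by
        rw [Real.mul_rpow (by norm_num) (by positivity),
          Real.mul_rpow (by positivity) (by positivity), ← Real.rpow_mul hW0,
          ← Real.rpow_mul hP0, inv_mul_cancel₀ (by positivity), Real.rpow_one,
          show (1 - (p / 2)⁻¹) * (p / 2) = p / 2 - 1 by field_simp]
        ring

lemma aux_filter_sum {n : ℕ} (i : Fin n) (G : ℕ → ℝ) :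
    ∑ j ∈ Finset.univ.filter (fun j : Fin n => j ≤ i), G j = ∑ k ∈ Finset.range (i + 1), G k := by
  refine Finset.sum_bij (fun j _ => (j : ℕ)) ?_ ?_ ?_ ?_
  · intro j hj
    simp only [Finset.mem_filter, Finset.mem_univ, true_and] at hj
    simp only [Finset.mem_range]
    have : (j : ℕ) ≤ i := hj
    omega
  · intro j _ k _ h
    exact Fin.ext h
  · intro k hk
    simp only [Finset.mem_range] at hk
    have := i.2
    refine ⟨⟨k, by omega⟩, ?_, rfl⟩
    simp only [Finset.mem_filter, Finset.mem_univ, true_and, Fin.le_def]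
    omega
  · intro j _
    rfl

set_option maxHeartbeats 1000000 in
open Matrix in
lemma aux_main {n d : ℕ} (p : ℝ) (hp : 0 < p) (A : Matrix (Fin n) (Fin d) ℝ) (hn : 2 ≤ n)
    (hA : A ≠ 0) :
    ∃ W : ℝ, 0 ≤ W ∧ W ≤ (4 * |1 - 2 / p| + 6) * d * Real.log (n * onlineCond A) ∧
      (∑ i : Fin n, onlineSensitivity p A i) ≤ (2 * W) ^ max 1 (p / 2) := by
  set N : ℝ := (n : ℝ) with hNdef
  have hN : (2 : ℝ) ≤ N := by rw [hNdef]; exact_mod_cast hn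
  have hN0 : 0 < N := by linarith
  set β := |1 - 2 / p| with hβ
  have hβ0 : 0 ≤ β := abs_nonneg _
  set σ := sigmaMinOnline A with hσ
  set τ := sigmaMax A with hτ
  have hσ0 : 0 < σ := aux_sigmaMin_pos A hA
  have hστ : σ ≤ τ := aux_sigmaMin_le_max A hA
  have hτ0 : 0 < τ := hσ0.trans_le hστ
  set κ := onlineCond A with hκdef
  have hκ : κ = τ / σ := rfl
  have hκ1 : 1 ≤ κ := by rw [hκ, le_div_iff₀ hσ0]; linarith
  have hd : (1 : ℝ) ≤ d := by
    obtain ⟨i, hi⟩ := aux_row_ne A hA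
    rcases Nat.eq_zero_or_pos d with h | h
    · subst h
      exact absurd (Subsingleton.elim _ _) hi
    · exact_mod_cast h
  set lam := σ ^ 2 * N ^ (-β) with hlam
  have hNβ : 0 < N ^ (-β) := by positivity
  have hlam0 : 0 < lam := by positivity
  set a : ℕ → Fin d → ℝ := fun k => if h : k < n then A ⟨k, h⟩ else 0 with ha
  have haA : ∀ j : Fin n, a j = A j := by
    intro j
    simp [ha]
  have hν1 : 1 / N ≤ 1 := by rw [div_le_one hN0]; linarith
  obtain ⟨w, M, hwν, hw1, hMpos, hM0, hMq, hMa, hMlog⟩ :=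
    aux_seq p hp lam hlam0 a (1 / N) (by positivity) hν1
  have hw0 : ∀ k, 0 < w k := fun k => lt_of_lt_of_le (by positivity) (hwν k)
  have hc : ∀ k, N ^ (-β) ≤ w k ^ (1 - 2 / p) ∧ w k ^ (1 - 2 / p) ≤ N ^ β := fun k =>
    aux_wpow (by linarith) (hwν k) (hw1 k)
  set W := ∑ k ∈ Finset.range n, w k with hW
  have hWpos : 0 < W := Finset.sum_pos (fun k _ => hw0 k) ⟨0, by simp; omega⟩
  refine ⟨W, hWpos.le, ?_, ?_⟩
  · -- the determinant bound
    have hfull : ∀ x, x ⬝ᵥ M n *ᵥ x ≤ (lam + N ^ β * τ ^ 2) * (x ⬝ᵥ x) := by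
      intro x
      rw [hMq, add_mul]
      gcongr
      calc ∑ j ∈ Finset.range n, w j ^ (1 - 2 / p) * (a j ⬝ᵥ x) ^ 2
          ≤ ∑ j ∈ Finset.range n, N ^ β * (a j ⬝ᵥ x) ^ 2 := by
            apply Finset.sum_le_sum
            intro j _
            exact mul_le_mul_of_nonneg_right (hc j).2 (sq_nonneg _)
        _ = N ^ β * ∑ j : Fin n, (A j ⬝ᵥ x) ^ 2 := by
            rw [← Finset.mul_sum, ← Fin.sum_univ_eq_sum_range (fun j => (a j ⬝ᵥ x) ^ 2)]
            simp only [haA]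
        _ ≤ N ^ β * (τ ^ 2 * (x ⬝ᵥ x)) := by
            gcongr
            exact aux_sigmaMax_sq_ge A x
        _ = _ := by ring
    have hdet := aux_det_le (M n) (hMpos n) _ hfull
    have hld : Real.log (M n).det ≤ d * Real.log (lam + N ^ β * τ ^ 2) := by
      rw [← Real.log_pow]
      exact Real.log_le_log (hMpos n).det_pos hdet
    have hl0 : Real.log (M 0).det = d * Real.log lam := by
      rw [hM0, det_smul, det_one]
      simp
    have hratio : Real.log (lam + N ^ β * τ ^ 2) - Real.log lam
        ≤ (2 * β + 2) * Real.log (N * κ) := by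
      rw [← Real.log_div (by positivity) hlam0.ne', ← Real.log_rpow (by positivity)]
      apply Real.log_le_log (by positivity)
      have e1 : (lam + N ^ β * τ ^ 2) / lam = 1 + N ^ (2 * β) * κ ^ 2 := by
        rw [hκ, hlam, Real.rpow_neg hN0.le, two_mul, Real.rpow_add hN0]
        field_simp
      rw [e1]
      have hNb1 : 1 ≤ N ^ (2 * β) := Real.one_le_rpow (by linarith) (by positivity)
      have hy : N ^ (2 * β) ≤ (N * κ) ^ (2 * β) := by
        apply Real.rpow_le_rpow hN0.le _ (by positivity)
        nlinarith
      have hk2 : 1 ≤ κ ^ 2 := one_le_pow₀ hκ1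
      calc 1 + N ^ (2 * β) * κ ^ 2 ≤ N ^ (2 * β) * (N * κ) ^ 2 := by
            have h1 : 1 ≤ N ^ (2 * β) * κ ^ 2 := by nlinarith
            have h2 : 2 ≤ N ^ 2 := by nlinarith
            calc 1 + N ^ (2 * β) * κ ^ 2 ≤ 2 * (N ^ (2 * β) * κ ^ 2) := by linarith
              _ ≤ N ^ 2 * (N ^ (2 * β) * κ ^ 2) := by gcongr
              _ = _ := by ring
        _ ≤ (N * κ) ^ (2 * β) * (N * κ) ^ 2 := by gcongr
        _ = _ := by
            rw [Real.rpow_add (by positivity)]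
            norm_num
    have hL : 1 / 2 ≤ Real.log (N * κ) := by
      have h1 : Real.log 2 ≤ Real.log (N * κ) := Real.log_le_log (by norm_num) (by nlinarith)
      have := Real.log_two_gt_d9
      linarith
    have h1 := hMlog n
    rw [hl0] at h1
    have h2 : (n : ℝ) * (1 / N) = 1 := by rw [← hNdef]; field_simp
    rw [h2] at h1
    have h3 : (d : ℝ) * (Real.log (lam + N ^ β * τ ^ 2) - Real.log lam)
        ≤ d * ((2 * β + 2) * Real.log (N * κ)) := by gcongr
    have h4 : 1 ≤ 2 * (d * Real.log (N * κ)) := by nlinarith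
    calc W ≤ _ := h1
      _ ≤ _ := by nlinarith
  · -- the sensitivity bound
    set q := max 1 (p / 2) with hq
    have hsens : ∀ i : Fin n, onlineSensitivity p A i ≤ 2 ^ q * W ^ (q - 1) * w i := by
      intro i
      apply Real.sSup_le
      · rintro r ⟨x, hx, hx0, rfl⟩
        set Q := x ⬝ᵥ M (i + 1) *ᵥ x with hQdef
        have hQ0 : 0 < Q := by simpa using (hMpos (i + 1)).dotProduct_mulVec_pos hx0
        have hPeq : prefixLpPow p A i x = ∑ k ∈ Finset.range (i + 1), |a k ⬝ᵥ x| ^ p := by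
          rw [← aux_filter_sum i (fun k => |a k ⬝ᵥ x| ^ p)]
          simp only [haA]
          rfl
        have hmono : ∀ j ∈ Finset.range ((i : ℕ) + 1), (a j ⬝ᵥ x) ^ 2 ≤ w j ^ (2 / p) * Q := by
          intro j hj
          refine (hMa j x).trans ?_
          refine mul_le_mul_of_nonneg_left ?_ (Real.rpow_nonneg (hw0 j).le _)
          rw [hQdef, hMq, hMq]
          refine add_le_add le_rfl ?_
          apply Finset.sum_le_sum_of_subset_of_nonneg
          · intro k hk
            simp only [Finset.mem_range] at *
            omega
          · intro k _ _
            exact mul_nonneg (Real.rpow_nonneg (hw0 k).le _) (sq_nonneg _)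
        have hQ2 : Q ≤ 2 * ∑ j ∈ Finset.range ((i : ℕ) + 1),
            w j ^ (1 - 2 / p) * (a j ⬝ᵥ x) ^ 2 := by
          rw [hQdef, hMq]
          have h1 := aux_sigmaMin_sq_le A hA i x hx
          have h2 : ∑ j ∈ Finset.univ.filter (fun j : Fin n => j ≤ i), (A j ⬝ᵥ x) ^ 2
              = ∑ k ∈ Finset.range ((i : ℕ) + 1), (a k ⬝ᵥ x) ^ 2 := by
            rw [← aux_filter_sum i (fun k => (a k ⬝ᵥ x) ^ 2)]
            simp only [haA]
          rw [h2] at h1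
          have h3 : lam * (x ⬝ᵥ x) ≤ ∑ j ∈ Finset.range ((i : ℕ) + 1),
              w j ^ (1 - 2 / p) * (a j ⬝ᵥ x) ^ 2 := by
            calc lam * (x ⬝ᵥ x) = N ^ (-β) * (σ ^ 2 * (x ⬝ᵥ x)) := by rw [hlam]; ring
              _ ≤ N ^ (-β) * ∑ k ∈ Finset.range ((i : ℕ) + 1), (a k ⬝ᵥ x) ^ 2 := by gcongr
              _ ≤ _ := by
                rw [Finset.mul_sum]
                apply Finset.sum_le_sum
                intro j _
                exact mul_le_mul_of_nonneg_right (hc j).1 (sq_nonneg _)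
          linarith
        have hWi : ∑ j ∈ Finset.range ((i : ℕ) + 1), w j ≤ W := by
          apply Finset.sum_le_sum_of_subset_of_nonneg
          · intro k hk
            simp only [Finset.mem_range] at *
            have := i.2
            omega
          · intro k _ _
            exact (hw0 k).le
        have hcore := aux_core (Finset.range ((i : ℕ) + 1)) p hp w (fun k => a k ⬝ᵥ x) Q W hw0
          hQ0 hWi hmono hQ2
        rw [← hPeq, ← hq] at hcore
        have hP0 : 0 ≤ prefixLpPow p A i x := by
          rw [hPeq]
          exact Finset.sum_nonneg fun j _ => by positivity
        have hnum : |∑ k, A i k * x k| ^ p ≤ w i * Q ^ (p / 2) := by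
          have h1 := hmono i (by simp)
          rw [haA] at h1
          have h2 := Real.rpow_le_rpow (sq_nonneg _) h1 (show 0 ≤ p / 2 by positivity)
          rw [Real.mul_rpow (Real.rpow_nonneg (hw0 i).le _) hQ0.le, ← Real.rpow_mul (hw0 i).le,
            show 2 / p * (p / 2) = 1 by field_simp, Real.rpow_one, ← sq_abs,
            ← Real.rpow_natCast, ← Real.rpow_mul (abs_nonneg _),
            show ((2 : ℕ) : ℝ) * (p / 2) = p by push_cast; ring] at h2
          exact h2
        apply div_le_of_le_mul₀ hP0
        · have := (hw0 i).le
          positivity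
        · calc _ ≤ _ := hnum
            _ ≤ w i * (2 ^ q * W ^ (q - 1) * prefixLpPow p A i x) :=
                mul_le_mul_of_nonneg_left hcore (hw0 i).le
            _ = _ := by ring
      · have := (hw0 i).le
        positivity
    calc ∑ i : Fin n, onlineSensitivity p A i ≤ ∑ i : Fin n, 2 ^ q * W ^ (q - 1) * w i :=
          Finset.sum_le_sum fun i _ => hsens i
      _ = 2 ^ q * W ^ (q - 1) * W := by
          rw [← Finset.mul_sum, Fin.sum_univ_eq_sum_range w n]
      _ = (2 * W) ^ q := by
          rw [Real.mul_rpow (by norm_num) hWpos.le, mul_assoc]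
          congr 1
          nth_rewrite 2 [← Real.rpow_one W]
          rw [← Real.rpow_add hWpos]
          congr 1
          ring


/-- **Sum of online `ℓ_p` sensitivities** (Corollary 3.9 of Woodruff–Yasuda).
For every `p > 0` there is a constant `C_p > 0` such that every nonzero matrix
`A ∈ ℝ^{n×d}` (`n ≥ 2`) with online condition number `κ^{OL}` satisfies
`∑ i s_i ≤ (C_p · d · log (n·κ^{OL}))^{max 1 (p/2)}`. -/
theorem sum_online_lp_sensitivities_le (p : ℝ) (hp : 0 < p) :
    ∃ C : ℝ, 0 < C ∧
      ∀ (n d : ℕ) (A : Matrix (Fin n) (Fin d) ℝ), 2 ≤ n → A ≠ 0 →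
        (∑ i : Fin n, onlineSensitivity p A i) ≤
          (C * d * Real.log (n * onlineCond A)) ^ max 1 (p / 2) := by
  refine ⟨2 * (4 * |1 - 2 / p| + 6), by positivity, ?_⟩
  intro n d A hn hA
  obtain ⟨W, hW0, hW, h⟩ := aux_main p hp A hn hA
  refine h.trans ?_
  apply Real.rpow_le_rpow (by positivity) _ (le_trans zero_le_one (le_max_left _ _))
  linarith
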